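/- arXiv:1908.05173 — 2 statements merged into one kernel-verified Lean document; each statement's English description precedes it below -/
import Mathlib

section
/- If φ is a ring automorphism of ℝ[x,y], c is a nonzero real number, and g ∈ ℝ[x,y] satisfies φ(x² − y²) = c·g, then the total degree of g is at least 2. Consequently, AutDeg(x² − y²) = 2. -/
open MvPolynomial

/-- The polynomial ring `ℝ[x,y]`, realized as `MvPolynomial (Fin 2) ℝ`
with `X 0 = x` and `X 1 = y`. -/
abbrev P2 : Type := MvPolynomial (Fin 2) ℝ

/-- `f ∼ g` : there are an affine automorphism `θ ∈ Γ₂(ℝ)` (a ring automorphism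
of `ℝ[x,y]` sending `x` and `y` to polynomials of total degree at most 1)
and a nonzero `c ∈ ℝ` with `θ f = c • g`. -/
def AffEquiv (f g : P2) : Prop :=
  ∃ θ : P2 ≃+* P2, (θ (X 0)).totalDegree ≤ 1 ∧ (θ (X 1)).totalDegree ≤ 1 ∧
    ∃ c : ℝ, c ≠ 0 ∧ θ f = C c * g

/-- `f ≈ g` : there are a ring automorphism `φ` of `ℝ[x,y]` and a nonzero
`c ∈ ℝ` with `φ f = c • g`. -/
def AutEquiv (f g : P2) : Prop :=
  ∃ φ : P2 ≃+* P2, ∃ c : ℝ, c ≠ 0 ∧ φ f = C c * g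

/-- `AutDeg f` : the minimal total degree of a polynomial `g` with `g ≈ f`. -/
noncomputable def AutDeg (f : P2) : ℕ :=
  sInf {n : ℕ | ∃ g : P2, AutEquiv g f ∧ g.totalDegree = n}

theorem one_le_totalDegree_of_not_isUnit {σ K : Type*} [Field K] {p : MvPolynomial σ K}
    (h0 : p ≠ 0) (hp : ¬ IsUnit p) : 1 ≤ p.totalDegree := by
  by_contra! h
  have h1 := totalDegree_eq_zero_iff_eq_C.mp (Nat.lt_one_iff.mp h)
  apply hp
  rw [h1]
  refine IsUnit.map C (isUnit_iff_ne_zero.mpr fun h2 => h0 ?_)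
  rw [h1, h2, C_0]

theorem not_isUnit_of_eval_eq_zero {σ K : Type*} [Field K] {p : MvPolynomial σ K} {a : σ → K}
    (h : eval a p = 0) : ¬ IsUnit p := fun hp =>
  not_isUnit_zero (h ▸ hp.map (eval a))

theorem X_sub_X_ne_zero : (X 0 - X 1 : P2) ≠ 0 := fun h => by
  simpa using congrArg (eval ![(1 : ℝ), 0]) h

theorem X_add_X_ne_zero : (X 0 + X 1 : P2) ≠ 0 := fun h => by
  simpa using congrArg (eval ![(1 : ℝ), 0]) h

/-- Ring automorphisms cannot lower the total degree of `x² - y²` below two, as it is a product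
of two nonzero nonunits. -/
theorem two_le_totalDegree_map (φ : P2 ≃+* P2) :
    2 ≤ (φ (X 0 ^ 2 - X 1 ^ 2)).totalDegree := by
  have key (p : P2) (h0 : p ≠ 0) (h : eval (0 : Fin 2 → ℝ) p = 0) :
      1 ≤ (φ p).totalDegree :=
    one_le_totalDegree_of_not_isUnit ((map_ne_zero_iff φ φ.injective).mpr h0)
      fun hu => not_isUnit_of_eval_eq_zero h ((MulEquiv.isUnit_map φ).mp hu)
  have h1 := key _ X_sub_X_ne_zero (by simp)
  have h2 := key _ X_add_X_ne_zero (by simp)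
  rw [show (X 0 ^ 2 - X 1 ^ 2 : P2) = (X 0 - X 1) * (X 0 + X 1) by ring, map_mul,
    totalDegree_mul_of_isDomain ((map_ne_zero_iff φ φ.injective).mpr X_sub_X_ne_zero)
      ((map_ne_zero_iff φ φ.injective).mpr X_add_X_ne_zero)]
  omega

theorem X_sq_sub_X_sq_ne_zero : (X 0 ^ 2 - X 1 ^ 2 : P2) ≠ 0 := fun h => by
  simpa using congrArg (eval ![(1 : ℝ), 0]) h

theorem totalDegree_X_sq_sub_X_sq : (X 0 ^ 2 - X 1 ^ 2 : P2).totalDegree = 2 :=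
  le_antisymm ((totalDegree_sub _ _).trans (by simp))
    (two_le_totalDegree_map (RingEquiv.refl P2))

theorem stmt10 :
    (∀ (φ : P2 ≃+* P2) (c : ℝ) (g : P2), c ≠ 0 →
      φ (X 0 ^ 2 - X 1 ^ 2) = C c * g → 2 ≤ g.totalDegree) ∧
    AutDeg (X 0 ^ 2 - X 1 ^ 2) = 2 := by
  refine ⟨fun φ c g _ h => ?_, ?_⟩
  · have h2 := two_le_totalDegree_map φ
    rw [h] at h2
    simpa using h2.trans (totalDegree_mul _ _)
  · refine IsLeast.csInf_eq
      ⟨⟨_, ⟨RingEquiv.refl P2, 1, one_ne_zero, by simp⟩, totalDegree_X_sq_sub_X_sq⟩, ?_⟩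
    rintro _ ⟨g, ⟨φ, c, hc, h⟩, rfl⟩
    have hg : g = φ.symm (C c) * φ.symm (X 0 ^ 2 - X 1 ^ 2) := by
      rw [← map_mul, ← h, RingEquiv.symm_apply_apply]
    rw [hg, totalDegree_mul_of_isDomain
      ((map_ne_zero_iff _ φ.symm.injective).mpr (C_ne_zero.mpr hc))
      ((map_ne_zero_iff _ φ.symm.injective).mpr X_sq_sub_X_sq_ne_zero)]
    exact (two_le_totalDegree_map φ.symm).trans (Nat.le_add_left _ _)
end

section
/- Let f and g each belong to the following family of polynomials in ℝ[x,y]: x³ − x·y² − y² + H·x + I·y + J with J ∈ ℝ, I ≥ 0, and H + I ≤ −3/4; x³ − x·y² − y + H·x + J with J ≥ 0 and −1 ≤ H ≤ 1; x³ − x·y² + 1; x³ − x·y². If f ≈ g, then f = g. -/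
open MvPolynomial

/-- The table entries with canonical form `x³ - x·y²`. -/
def FamB (p : P2) : Prop :=
  (∃ H I J : ℝ, 0 ≤ I ∧ H + I ≤ -(3/4 : ℝ) ∧
    p = X 0 ^ 3 - X 0 * X 1 ^ 2 - X 1 ^ 2 + C H * X 0 + C I * X 1 + C J) ∨
  (∃ H J : ℝ, 0 ≤ J ∧ -1 ≤ H ∧ H ≤ 1 ∧
    p = X 0 ^ 3 - X 0 * X 1 ^ 2 - X 1 + C H * X 0 + C J) ∨
  p = X 0 ^ 3 - X 0 * X 1 ^ 2 + 1 ∨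
  p = X 0 ^ 3 - X 0 * X 1 ^ 2

/-- A cubic polynomial function on `ℝ²` that vanishes identically has zero coefficients. -/
lemma cubic_coeffs_eq_zero {k₁ k₂ k₃ k₄ k₅ k₆ k₇ k₈ k₉ k₀ : ℝ}
    (h : ∀ x y : ℝ, k₁ * x ^ 3 + k₂ * x ^ 2 * y + k₃ * x * y ^ 2 + k₄ * y ^ 3 +
      k₅ * x ^ 2 + k₆ * x * y + k₇ * y ^ 2 + k₈ * x + k₉ * y + k₀ = 0) :
    (k₁ = 0 ∧ k₂ = 0 ∧ k₃ = 0 ∧ k₄ = 0) ∧ (k₅ = 0 ∧ k₆ = 0 ∧ k₇ = 0) ∧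
      k₈ = 0 ∧ k₉ = 0 ∧ k₀ = 0 := by
  have h00 := h 0 0
  have h10 := h 1 0
  have h20 := h 2 0
  have h30 := h (-1) 0
  have h01 := h 0 1
  have h02 := h 0 2
  have h03 := h 0 (-1)
  have h11 := h 1 1
  have h12 := h 1 (-1)
  have h21 := h (-1) 1
  norm_num at *
  refine ⟨⟨?_, ?_, ?_, ?_⟩, ⟨?_, ?_, ?_⟩, ?_, ?_, ?_⟩ <;> linarith

/-- The real linear substitutions `(x, y) ↦ (a x + b y, a' x + b' y)` that rescale
`x³ - x y²`, described through its coefficients. -/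
lemma cubic_form_symmetries {a b a' b' c : ℝ} (hc : c ≠ 0)
    (h₁ : a * (a ^ 2 - a' ^ 2) = c) (h₂ : 3 * a ^ 2 * b - b * a' ^ 2 - 2 * a * a' * b' = 0)
    (h₃ : 3 * a * b ^ 2 - a * b' ^ 2 - 2 * b * a' * b' = -c)
    (h₄ : b * (b ^ 2 - b' ^ 2) = 0) :
    a ≠ 0 ∧ ∃ s : ℝ, (s = 1 ∨ s = -1) ∧
      ((b = 0 ∧ a' = 0 ∧ b' = s * a ∧ c = a ^ 3) ∨
        ((b = a ∨ b = -a) ∧ a' = -3 * s * a ∧ b' = s * b ∧ c = -8 * a ^ 3)) := by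
  have ha : a ≠ 0 := by rintro rfl; exact hc (by linarith)
  refine ⟨ha, ?_⟩
  have key : ∀ s : ℝ, s ^ 2 = 1 → b ≠ 0 → b' = s * b →
      (b = a ∨ b = -a) ∧ a' = -3 * s * a ∧ b' = s * b ∧ c = -8 * a ^ 3 := by
    intro s hs hb hb'
    subst hb'
    have e₁ : (3 * a + s * a') * (a - s * a') = 0 := by
      apply mul_left_cancel₀ hb
      linear_combination h₂ - b * a' ^ 2 * hs
    have e₂ : a - s * a' ≠ 0 := by
      intro h
      apply hc
      linear_combination -h₁ + a * (a + s * a') * h + a * a' ^ 2 * hs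
    have e₃ : a' = -3 * s * a := by
      have := (mul_eq_zero.mp e₁).resolve_right e₂
      linear_combination s * this - a' * hs
    subst e₃
    have hc' : c = -8 * a ^ 3 := by linear_combination -h₁ - 9 * a ^ 3 * hs
    refine ⟨?_, rfl, rfl, hc'⟩
    apply sq_eq_sq_iff_eq_or_eq_neg.mp
    apply mul_left_cancel₀ ha
    linear_combination h₃ / 8 - hc' / 8 - 5 / 8 * a * b ^ 2 * hs
  rcases eq_or_ne b 0 with rfl | hb
  · have hb' : b' ≠ 0 := by rintro rfl; exact hc (by linarith)
    have ha' : a' = 0 := by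
      apply mul_left_cancel₀ (mul_ne_zero ha hb')
      linear_combination -h₂ / 2
    subst ha'
    have : b' = a ∨ b' = -a := by
      apply sq_eq_sq_iff_eq_or_eq_neg.mp
      apply mul_left_cancel₀ ha
      linarith
    rcases this with h | h
    · exact ⟨1, .inl rfl, .inl ⟨rfl, rfl, by linarith, by linarith⟩⟩
    · exact ⟨-1, .inr rfl, .inl ⟨rfl, rfl, by linarith, by linarith⟩⟩
  · rcases sq_eq_sq_iff_eq_or_eq_neg.mp
      (sub_eq_zero.mp ((mul_eq_zero.mp h₄).resolve_left hb)) with h | h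
    · exact ⟨1, .inl rfl, .inr (key 1 (by norm_num) hb (by linarith))⟩
    · exact ⟨-1, .inr rfl, .inr (key (-1) (by norm_num) hb (by linarith))⟩

/-- The polynomial `x³ - x y² + m y² + H x + I y + J`. -/
noncomputable def cubicPoly (m H I J : ℝ) : P2 :=
  X 0 ^ 3 - X 0 * X 1 ^ 2 + C m * X 1 ^ 2 + C H * X 0 + C I * X 1 + C J

lemma totalDegree_cubicPoly_le (m H I J : ℝ) : (cubicPoly m H I J).totalDegree ≤ 3 := by
  have hX : ∀ (i : Fin 2) (n : ℕ), (X i ^ n : P2).totalDegree ≤ n := fun i n => by simp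
  have hCX : ∀ (r : ℝ) (p : P2), (C r * p).totalDegree ≤ p.totalDegree := fun r p =>
    (totalDegree_mul _ _).trans (by simp)
  unfold cubicPoly
  refine (totalDegree_add _ _).trans (max_le ((totalDegree_add _ _).trans (max_le
    ((totalDegree_add _ _).trans (max_le ((totalDegree_add _ _).trans (max_le
    ((totalDegree_sub _ _).trans (max_le (hX 0 3) ?_)) ?_)) ?_)) ?_)) (by simp))
  · exact (totalDegree_mul _ _).trans (by simp)
  all_goals exact (hCX _ _).trans (by simp)

/-- The coefficient vectors `(m, H, I, J)` of the members of the family. -/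
def FamCoeffs (m H I J : ℝ) : Prop :=
  (m = -1 ∧ 0 ≤ I ∧ H + I ≤ -(3 / 4)) ∨
    (m = 0 ∧ ((I = -1 ∧ 0 ≤ J ∧ -1 ≤ H ∧ H ≤ 1) ∨ (H = 0 ∧ I = 0 ∧ (J = 0 ∨ J = 1))))

lemma FamB.exists_coeffs {p : P2} (hp : FamB p) :
    ∃ m H I J : ℝ, FamCoeffs m H I J ∧ p = cubicPoly m H I J := by
  rcases hp with ⟨H, I, J, hI, hH, rfl⟩ | ⟨H, J, hJ, h1, h2, rfl⟩ | rfl | rfl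
  · exact ⟨-1, H, I, J, .inl ⟨rfl, hI, hH⟩, by simp [cubicPoly]; ring⟩
  · exact ⟨0, H, -1, J, .inr ⟨rfl, .inl ⟨rfl, hJ, h1, h2⟩⟩, by simp [cubicPoly]; ring⟩
  · exact ⟨0, 0, 0, 1, .inr ⟨rfl, .inr ⟨rfl, rfl, .inr rfl⟩⟩, by simp [cubicPoly]⟩
  · exact ⟨0, 0, 0, 0, .inr ⟨rfl, .inr ⟨rfl, rfl, .inl rfl⟩⟩, by simp [cubicPoly]⟩

lemma FamCoeffs.eq_of_scaling {m H I J m' H' I' J' l s : ℝ} (hl : l ≠ 0)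
    (hs : s = 1 ∨ s = -1) (hf : FamCoeffs m H I J) (hg : FamCoeffs m' H' I' J')
    (hm : m = l * m') (hH : H = l ^ 2 * H') (hI : s * I = l ^ 2 * I') (hJ : J = l ^ 3 * J') :
    m = m' ∧ H = H' ∧ I = I' ∧ J = J' := by
  have hl2 : 0 < l ^ 2 := by positivity
  rcases hf with ⟨rfl, hI0, hHI⟩ | ⟨rfl, hf⟩ <;> rcases hg with ⟨rfl, hI0', hHI'⟩ | ⟨rfl, hg⟩
  · obtain rfl : l = 1 := by linarith
    rcases hs with rfl | rfl <;> refine ⟨rfl, ?_, ?_, ?_⟩ <;> linarith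
  · norm_num at hm
  · exact absurd (by linarith) hl
  · rcases hf with ⟨rfl, hJ0, h1, h2⟩ | ⟨rfl, rfl, hJ0⟩ <;>
      rcases hg with ⟨rfl, hJ0', h1', h2'⟩ | ⟨rfl, rfl, hJ0'⟩
    · have hl1 : l ^ 2 = 1 := by rcases hs with rfl | rfl <;> linarith
      rw [hl1] at hH
      rcases (sq_eq_sq_iff_eq_or_eq_neg.mp (hl1.trans (one_pow 2).symm)) with rfl | rfl <;>
        refine ⟨rfl, ?_, rfl, ?_⟩ <;> linarith
    · rcases hs with rfl | rfl <;> norm_num at hI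
    · exact absurd hI (by simpa using hl)
    · refine ⟨rfl, rfl, rfl, ?_⟩
      rcases hJ0 with rfl | rfl <;> rcases hJ0' with rfl | rfl <;> simp [hl, eq_comm (a := (0 : ℝ))] at hJ ⊢

lemma FamCoeffs.eq_of_rotation {m H I J m' H' I' J' l s t : ℝ} (hl : l ≠ 0)
    (hs : s = 1 ∨ s = -1) (ht : t = 1 ∨ t = -1)
    (hf : FamCoeffs m H I J) (hg : FamCoeffs m' H' I' J') (hm : m = l * m')
    (hH : H - 3 * s * I + 9 / 4 * m ^ 2 = -2 * l ^ 2 * H')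
    (hI : H + s * I + 3 / 4 * m ^ 2 = -2 * t * l ^ 2 * I')
    (hJ : 9 / 16 * m ^ 3 + 3 / 4 * m * (H - s * I) + J = l ^ 3 * J') :
    m = m' ∧ H = H' ∧ I = I' ∧ J = J' := by
  have hl2 : 0 < l ^ 2 := by positivity
  rcases hf with ⟨rfl, hI0, hHI⟩ | ⟨rfl, hf⟩ <;> rcases hg with ⟨rfl, hI0', hHI'⟩ | ⟨rfl, hg⟩
  · obtain rfl : l = 1 := by linarith
    norm_num at hH hI hJ
    rcases hs with rfl | rfl <;> rcases ht with rfl | rfl <;>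
      refine ⟨rfl, ?_, ?_, ?_⟩ <;> linarith
  · norm_num at hm
  · exact absurd (by linarith) hl
  · norm_num at hH hI hJ
    rcases hf with ⟨rfl, hJ0, h1, h2⟩ | ⟨rfl, rfl, hJ0⟩ <;>
      rcases hg with ⟨rfl, hJ0', h1', h2'⟩ | ⟨rfl, rfl, hJ0'⟩
    · have hHH : H = H' ∧ l ^ 2 = 1 := by
        rcases hs with rfl | rfl <;> rcases ht with rfl | rfl
        · exfalso; linarith
        · have h3 : H = -1 := by nlinarith
          subst h3; constructor <;> nlinarith
        · have h3 : H = 1 := by nlinarith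
          subst h3; constructor <;> nlinarith
        · exfalso; linarith
      obtain ⟨rfl, hl1⟩ := hHH
      rcases (sq_eq_sq_iff_eq_or_eq_neg.mp (hl1.trans (one_pow 2).symm)) with rfl | rfl <;>
        refine ⟨rfl, rfl, rfl, ?_⟩ <;> linarith
    · exfalso
      rcases hs with rfl | rfl <;> linarith
    · exfalso
      rcases ht with rfl | rfl <;> norm_num at hI <;> exact hl hI
    · refine ⟨rfl, rfl, rfl, ?_⟩
      rcases hJ0 with rfl | rfl <;> rcases hJ0' with rfl | rfl <;> simp [hl, eq_comm (a := (0 : ℝ))] at hJ ⊢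

/-- Affinely equivalent members of the family have equal coefficients. -/
lemma FamCoeffs.eq_of_affine {m H I J m' H' I' J' a b e a' b' e' c : ℝ} (hc : c ≠ 0)
    (hf : FamCoeffs m H I J) (hg : FamCoeffs m' H' I' J')
    (h : ∀ x y : ℝ, (a * x + b * y + e) ^ 3 -
        (a * x + b * y + e) * (a' * x + b' * y + e') ^ 2 + m * (a' * x + b' * y + e') ^ 2 +
        H * (a * x + b * y + e) + I * (a' * x + b' * y + e') + J =
      c * (x ^ 3 - x * y ^ 2 + m' * y ^ 2 + H' * x + I' * y + J')) :
    m = m' ∧ H = H' ∧ I = I' ∧ J = J' := by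
  obtain ⟨⟨h₁, h₂, h₃, h₄⟩, ⟨h₅, h₆, h₇⟩, h₈, h₉, h₀⟩ := cubic_coeffs_eq_zero
    (k₁ := a * (a ^ 2 - a' ^ 2) - c) (k₂ := 3 * a ^ 2 * b - b * a' ^ 2 - 2 * a * a' * b')
    (k₃ := 3 * a * b ^ 2 - a * b' ^ 2 - 2 * b * a' * b' + c) (k₄ := b * (b ^ 2 - b' ^ 2))
    (k₅ := 3 * a ^ 2 * e - e * a' ^ 2 - 2 * a * a' * e' + m * a' ^ 2)
    (k₆ := 6 * a * b * e - 2 * e * a' * b' - 2 * a * b' * e' - 2 * b * a' * e' + 2 * m * a' * b')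
    (k₇ := 3 * b ^ 2 * e - e * b' ^ 2 - 2 * b * b' * e' + m * b' ^ 2 - c * m')
    (k₈ := 3 * a * e ^ 2 - a * e' ^ 2 - 2 * e * a' * e' + 2 * m * a' * e' + H * a + I * a' - c * H')
    (k₉ := 3 * b * e ^ 2 - b * e' ^ 2 - 2 * e * b' * e' + 2 * m * b' * e' + H * b + I * b' - c * I')
    (k₀ := e ^ 3 - e * e' ^ 2 + m * e' ^ 2 + H * e + I * e' + J - c * J')
    (fun x y => by linear_combination h x y)
  obtain ⟨ha, s, hs, hcase⟩ := cubic_form_symmetries hc (sub_eq_zero.mp h₁) h₂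
    (by linarith) h₄
  rcases hcase with ⟨rfl, rfl, rfl, rfl⟩ | ⟨hb, rfl, rfl, rfl⟩
  · have he : e = 0 := by
      have : 3 * a ^ 2 * e = 0 := by linear_combination h₅
      simpa [ha] using this
    subst he
    have hs0 : s ≠ 0 := by rcases hs with rfl | rfl <;> norm_num
    have he' : e' = 0 := by
      have : 2 * a * (s * a) * e' = 0 := by linear_combination -h₆
      simpa [ha, hs0] using this
    subst he'
    have hs2 : s ^ 2 = 1 := by rcases hs with rfl | rfl <;> norm_num
    refine FamCoeffs.eq_of_scaling (l := a) (s := s) ha hs hf hg ?_ ?_ ?_ ?_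
    · apply mul_left_cancel₀ (pow_ne_zero 2 ha)
      linear_combination h₇ - m * a ^ 2 * hs2
    · apply mul_left_cancel₀ ha
      linear_combination h₈
    · apply mul_left_cancel₀ ha
      linear_combination h₉
    · linear_combination h₀
  · obtain ⟨t, ht, rfl⟩ : ∃ t : ℝ, (t = 1 ∨ t = -1) ∧ b = t * a := by
      rcases hb with h | h
      · exact ⟨1, .inl rfl, by linarith⟩
      · exact ⟨-1, .inr rfl, by linarith⟩
    have hs2 : s ^ 2 = 1 := by rcases hs with rfl | rfl <;> norm_num
    have ht2 : t ^ 2 = 1 := by rcases ht with rfl | rfl <;> norm_num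
    have ht0 : t ≠ 0 := by rintro rfl; norm_num at ht2
    have q₁ : -6 * e + 6 * s * e' + 9 * m = 0 := by
      apply mul_left_cancel₀ (pow_ne_zero 2 ha)
      linear_combination h₅ + (9 * e - 9 * m) * a ^ 2 * hs2
    have q₂ : 12 * e + 4 * s * e' - 6 * m = 0 := by
      apply mul_left_cancel₀ (mul_ne_zero ht0 (pow_ne_zero 2 ha))
      linear_combination h₆ - (6 * e - 6 * m) * t * a ^ 2 * hs2
    have he : e = 3 / 4 * m := by linear_combination (q₂ - 2 / 3 * q₁) / 16
    have he' : e' = -3 / 4 * s * m := by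
      linear_combination s * (q₁ + q₂ / 2) / 8 - e' * hs2
    subst he he'
    refine FamCoeffs.eq_of_rotation (l := -2 * a) (s := s) (t := t) (by simpa using ha) hs ht hf hg
      ?_ ?_ ?_ ?_
    · apply mul_left_cancel₀ (pow_ne_zero 2 ha)
      rcases hs with rfl | rfl <;> linear_combination h₇ / 4 - m * a ^ 2 * ht2
    · apply mul_left_cancel₀ ha
      rcases hs with rfl | rfl <;> linear_combination h₈
    · apply mul_left_cancel₀ (mul_ne_zero ht0 ha)
      rcases hs with rfl | rfl <;> rcases ht with rfl | rfl <;> linear_combination h₉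
    · rcases hs with rfl | rfl <;> linear_combination h₀

/-- A polynomial of total degree at most one is affine. -/
lemma eval_eq_of_totalDegree_le_one {p : P2} (hp : p.totalDegree ≤ 1) :
    ∃ a b e : ℝ, ∀ v : Fin 2 → ℝ, eval v p = a * v 0 + b * v 1 + e := by
  refine ⟨coeff (Finsupp.single 0 1) p, coeff (Finsupp.single 1 1) p, coeff 0 p, fun v => ?_⟩
  have hsub : p.support ⊆ {Finsupp.single 0 1, Finsupp.single 1 1, 0} := by
    intro d hd
    have hdeg := (le_totalDegree hd).trans hp
    rw [Finsupp.sum_fintype _ _ (fun _ => rfl), Fin.sum_univ_two] at hdeg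
    have hcases : (d 0 = 1 ∧ d 1 = 0) ∨ (d 0 = 0 ∧ d 1 = 1) ∨ (d 0 = 0 ∧ d 1 = 0) := by omega
    simp only [Finset.mem_insert, Finset.mem_singleton]
    rcases hcases with h | h | h
    · left; ext i; fin_cases i <;> simp [h]
    · right; left; ext i; fin_cases i <;> simp [h]
    · right; right; ext i; fin_cases i <;> simp [h]
  have h01 : (Finsupp.single 0 1 : Fin 2 →₀ ℕ) ≠ Finsupp.single 1 1 := by
    intro h
    simpa using DFunLike.congr_fun h 0
  rw [eval_eq', Finset.sum_subset hsub (fun d _ hd => by simp [notMem_support_iff.mp hd]),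
    Finset.sum_insert (by simp [h01]), Finset.sum_insert (by simp), Finset.sum_singleton]
  simp [Fin.prod_univ_two]
  ring

/-- A ring automorphism of `ℝ[x,y]` fixes the constants. -/
lemma ringEquiv_C (φ : P2 ≃+* P2) (r : ℝ) : φ (C r) = C r := by
  have hconst : ∃ s, φ (C r) = C s := by
    rcases eq_or_ne r 0 with rfl | hr
    · exact ⟨0, by simp⟩
    · have hu : IsUnit (φ (C r)) := ((isUnit_iff_ne_zero.mpr hr).map C).map φ
      obtain ⟨s, -, hs⟩ := MvPolynomial.isUnit_iff_eq_C_of_isReduced.mp hu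
      exact ⟨s, hs⟩
  obtain ⟨s, hs⟩ := hconst
  have h := RingHom.congr_fun
    (Subsingleton.elim (constantCoeff.comp ((φ : P2 →+* P2).comp C)) (RingHom.id ℝ)) r
  have h' : s = r := by simpa only [RingHom.comp_apply, RingHom.coe_coe, hs, constantCoeff_C,
    RingHom.id_apply] using h
  rw [hs, h']

/-- If `P`, `P - Q` and `P + Q` are nonconstant and `P³ - P Q²` plus lower terms is a cubic,
then `P` and `Q` have degree at most one. -/
lemma totalDegree_le_one_of_cubic {P Q : P2} {m H I J : ℝ} (hP : P.totalDegree ≠ 0)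
    (hS : (P - Q).totalDegree ≠ 0) (hT : (P + Q).totalDegree ≠ 0)
    (h : (P ^ 3 - P * Q ^ 2 + C m * Q ^ 2 + C H * P + C I * Q + C J).totalDegree ≤ 3) :
    P.totalDegree ≤ 1 ∧ Q.totalDegree ≤ 1 := by
  have hP0 : P ≠ 0 := by rintro rfl; simp at hP
  have hS0 : P - Q ≠ 0 := by intro h; simp [h] at hS
  have hT0 : P + Q ≠ 0 := by intro h; simp [h] at hT
  have hprod : (P * ((P - Q) * (P + Q))).totalDegree =
      P.totalDegree + ((P - Q).totalDegree + (P + Q).totalDegree) := by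
    rw [totalDegree_mul_of_isDomain hP0 (mul_ne_zero hS0 hT0),
      totalDegree_mul_of_isDomain hS0 hT0]
  set d := max P.totalDegree Q.totalDegree with hd
  have hlow : (C m * Q ^ 2 + C H * P + C I * Q + C J : P2).totalDegree ≤ 2 * d := by
    have hCm : ∀ (r : ℝ) (p : P2), (C r * p).totalDegree ≤ p.totalDegree := fun r p =>
      (totalDegree_mul _ _).trans (by simp)
    refine (totalDegree_add _ _).trans (max_le ((totalDegree_add _ _).trans
      (max_le ((totalDegree_add _ _).trans (max_le ?_ ?_)) ?_)) (by simp))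
    · exact (hCm _ _).trans ((totalDegree_pow _ _).trans (by omega))
    · exact (hCm _ _).trans (by omega)
    · exact (hCm _ _).trans (by omega)
  have hle : P.totalDegree + ((P - Q).totalDegree + (P + Q).totalDegree) ≤ max 3 (2 * d) := by
    rw [← hprod]
    have : P * ((P - Q) * (P + Q)) = (P ^ 3 - P * Q ^ 2 + C m * Q ^ 2 + C H * P + C I * Q + C J) -
        (C m * Q ^ 2 + C H * P + C I * Q + C J) := by ring
    rw [this]
    exact (totalDegree_sub _ _).trans (max_le_max h hlow)
  have hPS : P.totalDegree ≤ max (P - Q).totalDegree Q.totalDegree := by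
    simpa using totalDegree_add (P - Q) Q
  have hQS : Q.totalDegree ≤ max P.totalDegree (P - Q).totalDegree := by
    simpa using totalDegree_sub P (P - Q)
  have hQT : Q.totalDegree ≤ max (P + Q).totalDegree P.totalDegree := by
    simpa using totalDegree_sub (P + Q) P
  have hPT : P.totalDegree ≤ max (P + Q).totalDegree Q.totalDegree := by
    simpa using totalDegree_sub (P + Q) Q
  have hhalf : ∀ p : P2, (p + p).totalDegree = p.totalDegree := fun p => by
    rcases eq_or_ne p 0 with rfl | hp
    · simp
    · rw [← two_mul, ← map_ofNat (C : ℝ →+* P2) 2, totalDegree_mul_of_isDomain (by simp) hp]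
      simp
  have hPST : P.totalDegree ≤ max (P - Q).totalDegree (P + Q).totalDegree := by
    rw [← hhalf P, show P + P = (P - Q) + (P + Q) by ring]
    exact totalDegree_add _ _
  have hQST : Q.totalDegree ≤ max (P + Q).totalDegree (P - Q).totalDegree := by
    rw [← hhalf Q, show Q + Q = (P + Q) - (P - Q) by ring]
    exact totalDegree_sub _ _
  omega

theorem stmt12 (f g : P2) (hf : FamB f) (hg : FamB g) (h : AutEquiv f g) :
    f = g := by
  obtain ⟨m, H, I, J, hc, rfl⟩ := hf.exists_coeffs
  obtain ⟨m', H', I', J', hc', rfl⟩ := hg.exists_coeffs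
  obtain ⟨φ, c, hc0, hφ⟩ := h
  have nonconst : ∀ p : P2, p.totalDegree ≠ 0 → (φ p).totalDegree ≠ 0 := by
    intro p hp h0
    rw [totalDegree_eq_zero_iff_eq_C] at h0
    rw [← ringEquiv_C φ, φ.injective.eq_iff] at h0
    exact hp (h0 ▸ totalDegree_C _)
  have hXP : (X 0 : P2).totalDegree ≠ 0 := by simp
  have hXS : (X 0 - X 1 : P2).totalDegree ≠ 0 := by
    intro h0
    have h1 := totalDegree_eq_zero_iff_eq_C.mp h0
    have e1 := congrArg (eval ![0, 0]) h1
    have e2 := congrArg (eval ![1, 0]) h1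
    simp only [map_sub, eval_X, eval_C] at e1 e2
    simp [← e1] at e2
  have hXT : (X 0 + X 1 : P2).totalDegree ≠ 0 := by
    intro h0
    have h1 := totalDegree_eq_zero_iff_eq_C.mp h0
    have e1 := congrArg (eval ![0, 0]) h1
    have e2 := congrArg (eval ![1, 0]) h1
    simp only [map_add, eval_X, eval_C] at e1 e2
    simp [← e1] at e2
  have hφ' : (φ (X 0)) ^ 3 - φ (X 0) * φ (X 1) ^ 2 + C m * φ (X 1) ^ 2 + C H * φ (X 0) +
      C I * φ (X 1) + C J = C c * cubicPoly m' H' I' J' := by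
    simpa only [cubicPoly, map_add, map_sub, map_mul, map_pow, ringEquiv_C] using hφ
  obtain ⟨hP, hQ⟩ := totalDegree_le_one_of_cubic (nonconst _ hXP)
    (by simpa only [map_sub] using nonconst _ hXS) (by simpa only [map_add] using nonconst _ hXT)
    (hφ' ▸ (totalDegree_mul _ _).trans (by
      simpa using totalDegree_cubicPoly_le m' H' I' J'))
  obtain ⟨a, b, e, hPe⟩ := eval_eq_of_totalDegree_le_one hP
  obtain ⟨a', b', e', hQe⟩ := eval_eq_of_totalDegree_le_one hQ
  obtain ⟨rfl, rfl, rfl, rfl⟩ := hc.eq_of_affine hc0 hc' (a := a) (b := b) (e := e)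
    (a' := a') (b' := b') (e' := e') fun x y => by
      have := congrArg (eval ![x, y]) hφ'
      simpa [cubicPoly, hPe, hQe] using this
  rfl
end
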